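/- arXiv:1509.03129 — 2 statements merged into one kernel-verified Lean document; each statement's English description precedes it below -/
import Mathlib

section
/- Fix an integer m ≥ 3. Let λ_{ij;k} be nonzero real constants and p_{ij;kℓ} real constants, and let A_{ij;k}(x_{ij},x_{ik},x_{jk}) be homogeneous polynomials of degree m over ℝ, all indexed by labels (ij;k) with i,j,k ∈ {1,2,3,4} (with A_{ij;k} = A_{ji;k}, λ_{ij;k} = λ_{ji;k}). Suppose that for every {i,j,k,ℓ} = {1,2,3,4} the expression 2λ_{ij;k}·x_{ij}·A_{ij;ℓ} + λ_{ij;ℓ}·x_{ij}²·∂A_{ij;k}/∂x_{ij} + λ_{ik;ℓ}·x_{ik}²·∂A_{ij;k}/∂x_{ik} + λ_{jk;ℓ}·x_{jk}²·∂A_{ij;k}/∂x_{jk} − 2λ_{ij;ℓ}·x_{ij}·A_{ij;k} − λ_{ij;k}·x_{ij}²·∂A_{ij;ℓ}/∂x_{ij} − λ_{iℓ;k}·x_{iℓ}²·∂A_{ij;ℓ}/∂x_{iℓ} − λ_{jℓ;k}·x_{jℓ}²·∂A_{ij;ℓ}/∂x_{jℓ} + p_{ij;kℓ}·x_{ij}^{m+1}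 vanishes identically in the six variables x_{pq} = x_{qp} (each A_{pq;r} evaluated at (x_{pq}, x_{pr}, x_{qr})). Then each A_{ij;k}(X,Y,Z) is independent of its second and third arguments, i.e. A_{ij;k}(X,Y,Z) = λ^{(m)}_{ij;k}·X^m for some constant λ^{(m)}_{ij;k}. -/
/- Statement 11: in case (II), if the homogeneous degree-`m` polynomials `A_{ij;k}` satisfy the
   vanishing of the degree-`(m+1)` part of the consistency condition (with nonzero constants
   `λ_{ij;k}` and some constants `p_{ij;kℓ}`), then each `A_{ij;k}` is `λ' x_{ij}^m`,
   i.e. independent of its second and third arguments. -/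

noncomputable section

open MvPolynomial

/-- The variable index of `x_{ij} = x_{ji}`: the sorted pair. -/
def vd (i j : Fin 4) : Fin 4 × Fin 4 := if i ≤ j then (i, j) else (j, i)

/-- The variable `x_{ij}` in the polynomial ring in the six variables `x_{pq}`. -/
def xv (i j : Fin 4) : MvPolynomial (Fin 4 × Fin 4) ℝ := X (vd i j)

/-- Evaluation of the three-variable polynomial `A_{ij;k}` at `(x_{ij}, x_{ik}, x_{jk})`,
    as a polynomial in the six variables `x_{pq}`. -/
def ev (A : Fin 4 → Fin 4 → Fin 4 → MvPolynomial (Fin 3) ℝ) (i j k : Fin 4) :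
    MvPolynomial (Fin 4 × Fin 4) ℝ :=
  aeval ![xv i j, xv i k, xv j k] (A i j k)

theorem vd_injective : ∀ i j k : Fin 4, i ≠ j → i ≠ k → j ≠ k →
    Function.Injective ![vd i j, vd i k, vd j k] := by
  unfold Function.Injective
  decide

set_option synthInstance.maxSize 1024 in
theorem exists_fourth_index : ∀ i j k : Fin 4, i ≠ j → i ≠ k → j ≠ k →
    ∃ l : Fin 4, i ≠ l ∧ j ≠ l ∧ k ≠ l ∧ ({i, j, k, l} : Finset (Fin 4)) = Finset.univ := by
  decide

theorem vd_notMem_range : ∀ i j k l : Fin 4, i ≠ j → i ≠ k → j ≠ k → i ≠ l → j ≠ l → k ≠ l →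
    ∀ x, ![vd i j, vd i k, vd j k] x ≠ vd i l ∧ ![vd i j, vd i k, vd j k] x ≠ vd j l := by
  decide

theorem ev_eq_rename (A : Fin 4 → Fin 4 → Fin 4 → MvPolynomial (Fin 3) ℝ) (i j k : Fin 4) :
    ev A i j k = rename ![vd i j, vd i k, vd j k] (A i j k) := by
  unfold ev
  rw [rename_eq_aeval]
  congr 2
  funext x
  fin_cases x <;> rfl

/-- Monomials involving the last two variables do not occur after these are set to zero. -/
theorem coeff_aeval_X_zero_zero {R : Type*} [CommRing R] (Q : MvPolynomial (Fin 3) R)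
    (d : Fin 3 →₀ ℕ) (hd : d 1 ≠ 0 ∨ d 2 ≠ 0) :
    coeff d (aeval ![X 0, 0, 0] Q : MvPolynomial (Fin 3) R) = 0 := by
  induction Q using MvPolynomial.induction_on generalizing d with
  | C a =>
    have h : 0 ≠ d := by
      rintro rfl
      simp at hd
    rw [aeval_C, algebraMap_eq, coeff_C, if_neg h]
  | add P Q hP hQ => rw [map_add, coeff_add, hP d hd, hQ d hd, add_zero]
  | mul_X P n hP =>
    rw [map_mul, aeval_X]
    fin_cases n
    · rw [show (![X 0, 0, 0] : Fin 3 → MvPolynomial (Fin 3) R) ⟨0, by simp⟩ = X 0 from rfl,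
        coeff_mul_X']
      split_ifs
      · exact hP _ (by simpa using hd)
      · rfl
    · simp
    · simp

/-- Coefficients of `X i ^ 2 * ∂F/∂X i`. -/
theorem coeff_X_sq_mul_pderiv {σ R : Type*} [CommRing R] (F : MvPolynomial σ R) (i : σ)
    (d : σ →₀ ℕ) :
    coeff (d + Finsupp.single i 1) (X i ^ 2 * pderiv i F) = d i * coeff d F := by
  classical
  rw [pow_two, mul_assoc, mul_comm, coeff_mul_X, mul_comm, coeff_mul_X', coeff_pderiv]
  by_cases h : d i = 0
  · simp [h]
  · have h1 : d - Finsupp.single i 1 + Finsupp.single i 1 = d :=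
      tsub_add_cancel_of_le (by simpa [Nat.one_le_iff_ne_zero] using h)
    have h2 : (((d - Finsupp.single i 1 : σ →₀ ℕ) i : ℕ) : R) + 1 = d i := by
      rw [← Nat.cast_add_one]
      congr 1
      simp
      omega
    rw [if_pos (by simpa using h), h1, h2, mul_comm]

theorem coeff_X_sq_mul_pderiv_of_eq_zero {σ R : Type*} [CommRing R] (F : MvPolynomial σ R) (i : σ)
    (d : σ →₀ ℕ) (hd : d i = 0) : coeff d (X i ^ 2 * pderiv i F) = 0 := by
  classical
  rw [pow_two, mul_assoc, mul_comm, coeff_mul_X', if_neg (by simpa using hd)]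

/-- A polynomial whose image under `b X₀² ∂₀ + c X₁² ∂₁ + e X₂² ∂₂ - 2 b X₀` involves only `X₀`
involves only `X₀` itself. -/
theorem coeff_eq_zero_of_quadratic_field {K : Type*} [Field K] [CharZero K]
    (F : MvPolynomial (Fin 3) K) (b c e : K) (hc : c ≠ 0) (he : e ≠ 0)
    (H : ∀ d : Fin 3 →₀ ℕ, d 1 ≠ 0 ∨ d 2 ≠ 0 →
      b * coeff d (X 0 ^ 2 * pderiv 0 F) + c * coeff d (X 1 ^ 2 * pderiv 1 F) +
        e * coeff d (X 2 ^ 2 * pderiv 2 F) - 2 * b * coeff d (X 0 * F) = 0)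
    (d : Fin 3 →₀ ℕ) (hd : d 1 ≠ 0 ∨ d 2 ≠ 0) : coeff d F = 0 := by
  classical
  obtain ⟨n, hn⟩ : ∃ n, d 0 = n := ⟨_, rfl⟩
  induction n using Nat.strong_induction_on generalizing d with
  | _ n ih =>
    have first : ∀ d' : Fin 3 →₀ ℕ, d' 0 = n → d' 1 ≠ 0 ∨ d' 2 ≠ 0 →
        coeff d' (X 0 ^ 2 * pderiv 0 F) = 0 ∧ coeff d' (X 0 * F) = 0 := by
      intro d' h0 h12
      by_cases hz : d' 0 = 0
      · exact ⟨coeff_X_sq_mul_pderiv_of_eq_zero F 0 d' hz, by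
          rw [mul_comm, coeff_mul_X', if_neg (by simpa using hz)]⟩
      · obtain ⟨g, rfl⟩ : ∃ g, d' = g + Finsupp.single 0 1 :=
          ⟨d' - Finsupp.single 0 1,
            (tsub_add_cancel_of_le (by simpa [Nat.one_le_iff_ne_zero] using hz)).symm⟩
        have hg : coeff g F = 0 :=
          ih (g 0) (by simp at h0; omega) g (by simpa using h12) rfl
        exact ⟨by rw [coeff_X_sq_mul_pderiv, hg, mul_zero], by rw [mul_comm, coeff_mul_X, hg]⟩
    have pos : ∀ (k : ℕ) (d' : Fin 3 →₀ ℕ), d' 1 = k → d' 0 = n → d' 2 ≠ 0 →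
        coeff d' F = 0 := by
      intro k
      induction k with
      | zero =>
        intro d' h1 h0 h2
        have hd' : (d' + Finsupp.single 2 1 : Fin 3 →₀ ℕ) 1 ≠ 0 ∨ (d' + Finsupp.single 2 1 : Fin 3 →₀ ℕ) 2 ≠ 0 :=
          Or.inr (by simp)
        have key := H _ hd'
        obtain ⟨ha, hb⟩ := first _ (by simpa using h0) hd'
        rw [ha, hb, coeff_X_sq_mul_pderiv,
          coeff_X_sq_mul_pderiv_of_eq_zero F 1 _ (by simpa using h1)] at key
        simpa [he, h2] using key
      | succ k ihk =>
        intro d' h1 h0 h2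
        have hd' : (d' + Finsupp.single 2 1 : Fin 3 →₀ ℕ) 1 ≠ 0 ∨ (d' + Finsupp.single 2 1 : Fin 3 →₀ ℕ) 2 ≠ 0 :=
          Or.inr (by simp)
        have key := H _ hd'
        obtain ⟨ha, hb⟩ := first _ (by simpa using h0) hd'
        obtain ⟨g, rfl⟩ : ∃ g, d' = g + Finsupp.single 1 1 :=
          ⟨d' - Finsupp.single 1 1, (tsub_add_cancel_of_le (by simp [h1])).symm⟩
        have hg : coeff (g + Finsupp.single 2 1) F = 0 :=
          ihk _ (by simpa using h1) (by simpa using h0) (by simp)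
        have hm : coeff (g + Finsupp.single 1 1 + Finsupp.single 2 1) (X 1 ^ 2 * pderiv 1 F) = 0 := by
          rw [add_right_comm, coeff_X_sq_mul_pderiv, hg, mul_zero]
        rw [ha, hb, hm, coeff_X_sq_mul_pderiv] at key
        have h2' : g 2 ≠ 0 := by simpa using h2
        simpa [he, h2'] using key
    by_cases h2 : d 2 = 0
    · have h1 : d 1 ≠ 0 := hd.resolve_right (not_not.mpr h2)
      have hd' : (d + Finsupp.single 1 1 : Fin 3 →₀ ℕ) 1 ≠ 0 ∨ (d + Finsupp.single 1 1 : Fin 3 →₀ ℕ) 2 ≠ 0 :=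
        Or.inl (by simp)
      have key := H _ hd'
      obtain ⟨ha, hb⟩ := first _ (by simpa using hn) hd'
      rw [ha, hb, coeff_X_sq_mul_pderiv,
        coeff_X_sq_mul_pderiv_of_eq_zero F 2 _ (by simpa using h2)] at key
      simpa [hc, h1] using key
    · exact pos _ d rfl hn h2

theorem eq_C_mul_X_pow_of_coeff_eq_zero {R : Type*} [CommRing R] {F : MvPolynomial (Fin 3) R}
    {m : ℕ} (hF : F.IsHomogeneous m)
    (h : ∀ d : Fin 3 →₀ ℕ, d 1 ≠ 0 ∨ d 2 ≠ 0 → coeff d F = 0) :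
    ∃ c, F = C c * X 0 ^ m := by
  refine ⟨coeff (Finsupp.single 0 m) F, ?_⟩
  ext d
  rw [coeff_C_mul, coeff_X_pow]
  split_ifs with hd
  · rw [← hd, mul_one]
  · rw [mul_zero]
    by_contra hne
    have h12 : d 1 = 0 ∧ d 2 = 0 := by
      by_contra hcon
      exact hne (h d (by tauto))
    have hdeg : d.degree = m := by
      by_contra hdeg
      exact hne (hF.coeff_eq_zero hdeg)
    rw [Finsupp.degree_eq_sum, Fin.sum_univ_three, h12.1, h12.2] at hdeg
    refine hd ?_
    ext x
    fin_cases x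
    · simpa using hdeg.symm
    · simpa using h12.1.symm
    · simpa using h12.2.symm

theorem stmt_11 (m : ℕ) (hm : 3 ≤ m)
    (lam : Fin 4 → Fin 4 → Fin 4 → ℝ) (p : Fin 4 → Fin 4 → Fin 4 → Fin 4 → ℝ)
    (A : Fin 4 → Fin 4 → Fin 4 → MvPolynomial (Fin 3) ℝ)
    (hlamsym : ∀ i j k, lam i j k = lam j i k)
    (hlam : ∀ i j k : Fin 4, i ≠ j → i ≠ k → j ≠ k → lam i j k ≠ 0)
    (hhom : ∀ i j k : Fin 4, i ≠ j → i ≠ k → j ≠ k → (A i j k).IsHomogeneous m)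
    (hsym : ∀ i j k : Fin 4, i ≠ j → i ≠ k → j ≠ k →
      A j i k = rename (Equiv.swap (1 : Fin 3) 2) (A i j k))
    (hvanish : ∀ i j k l : Fin 4, ({i, j, k, l} : Finset (Fin 4)) = Finset.univ →
      C (2 * lam i j k) * xv i j * ev A i j l +
          C (lam i j l) * xv i j ^ 2 * pderiv (vd i j) (ev A i j k) +
          C (lam i k l) * xv i k ^ 2 * pderiv (vd i k) (ev A i j k) +
          C (lam j k l) * xv j k ^ 2 * pderiv (vd j k) (ev A i j k) -
          C (2 * lam i j l) * xv i j * ev A i j k -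
          C (lam i j k) * xv i j ^ 2 * pderiv (vd i j) (ev A i j l) -
          C (lam i l k) * xv i l ^ 2 * pderiv (vd i l) (ev A i j l) -
          C (lam j l k) * xv j l ^ 2 * pderiv (vd j l) (ev A i j l) +
          C (p i j k l) * xv i j ^ (m + 1) = 0) :
    ∀ i j k : Fin 4, i ≠ j → i ≠ k → j ≠ k →
      ∃ c : ℝ, A i j k = C c * X 0 ^ m := by
  intro i j k hij hik hjk
  obtain ⟨l, hil, hjl, hkl, huniv⟩ := exists_fourth_index i j k hij hik hjk
  have hv := hvanish i j k l huniv
  have hinj := vd_injective i j k hij hik hjk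
  have hinj' := vd_injective i j l hij hil hjl
  have hrange := vd_notMem_range i j k l hij hik hjk hil hjl hkl
  refine eq_C_mul_X_pow_of_coeff_eq_zero (hhom i j k hij hik hjk)
    (coeff_eq_zero_of_quadratic_field (A i j k) (lam i j l) (lam i k l) (lam j k l)
      (hlam i k l hik hil hkl) (hlam j k l hjk hjl hkl) ?_)
  rw [ev_eq_rename, ev_eq_rename] at hv
  unfold xv at hv
  set f : Fin 3 → Fin 4 × Fin 4 := ![vd i j, vd i k, vd j k] with hf
  set g : Fin 3 → Fin 4 × Fin 4 := ![vd i j, vd i l, vd j l] with hg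
  have hf0 (F : MvPolynomial (Fin 3) ℝ) :
      pderiv (vd i j) (rename f F) = rename f (pderiv 0 F) := pderiv_rename hinj 0 F
  have hf1 (F : MvPolynomial (Fin 3) ℝ) :
      pderiv (vd i k) (rename f F) = rename f (pderiv 1 F) := pderiv_rename hinj 1 F
  have hf2 (F : MvPolynomial (Fin 3) ℝ) :
      pderiv (vd j k) (rename f F) = rename f (pderiv 2 F) := pderiv_rename hinj 2 F
  have hg0 (F : MvPolynomial (Fin 3) ℝ) :
      pderiv (vd i j) (rename g F) = rename g (pderiv 0 F) := pderiv_rename hinj' 0 F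
  have hg1 (F : MvPolynomial (Fin 3) ℝ) :
      pderiv (vd i l) (rename g F) = rename g (pderiv 1 F) := pderiv_rename hinj' 1 F
  have hg2 (F : MvPolynomial (Fin 3) ℝ) :
      pderiv (vd j l) (rename g F) = rename g (pderiv 2 F) := pderiv_rename hinj' 2 F
  rw [hf0, hf1, hf2, hg0, hg1, hg2] at hv
  have hk (F : MvPolynomial (Fin 3) ℝ) : killCompl hinj (rename f F) = F :=
    killCompl_rename_app hinj F
  have hX0 : killCompl hinj (X (vd i j) : MvPolynomial _ ℝ) = X 0 := by
    simpa [hf] using hk (X 0)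
  have hX1 : killCompl hinj (X (vd i k) : MvPolynomial _ ℝ) = X 1 := by
    simpa [hf] using hk (X 1)
  have hX2 : killCompl hinj (X (vd j k) : MvPolynomial _ ℝ) = X 2 := by
    simpa [hf] using hk (X 2)
  have hY1 : killCompl hinj (X (vd i l) : MvPolynomial _ ℝ) = 0 := by
    rw [killCompl, aeval_X, dif_neg]
    rintro ⟨x, hx⟩
    exact (hrange x).1 hx
  have hY2 : killCompl hinj (X (vd j l) : MvPolynomial _ ℝ) = 0 := by
    rw [killCompl, aeval_X, dif_neg]
    rintro ⟨x, hx⟩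
    exact (hrange x).2 hx
  have hkg (F : MvPolynomial (Fin 3) ℝ) :
      killCompl hinj (rename g F) = aeval ![X 0, 0, 0] F := by
    rw [← AlgHom.comp_apply]
    refine DFunLike.congr_fun ?_ F
    ext1 x
    fin_cases x
    · simpa [hg] using hX0
    · simpa [hg] using hY1
    · simpa [hg] using hY2
  have hC (r : ℝ) : killCompl hinj (C r) = C r := by
    simp [killCompl]
  have hv' := congrArg (killCompl hinj) hv
  simp only [map_add, map_sub, map_mul, map_pow, map_zero, hk, hkg, hX0, hX1, hX2, hY1, hY2] at hv'
  simp only [← map_mul, hC] at hv'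
  intro d hd
  have hQ := coeff_aeval_X_zero_zero (C (lam i j k) * X 0 ^ 2 * pderiv 0 (A i j l) -
    C (2 * lam i j k) * X 0 * A i j l - C (p i j k l) * X 0 ^ (m + 1)) d hd
  rw [show (aeval ![X 0, 0, 0] (C (lam i j k) * X 0 ^ 2 * pderiv 0 (A i j l) -
      C (2 * lam i j k) * X 0 * A i j l - C (p i j k l) * X 0 ^ (m + 1)) :
        MvPolynomial (Fin 3) ℝ) =
      C (lam i j l) * (X 0 ^ 2 * pderiv 0 (A i j k)) +
      C (lam i k l) * (X 1 ^ 2 * pderiv 1 (A i j k)) +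
      C (lam j k l) * (X 2 ^ 2 * pderiv 2 (A i j k)) -
      C (2 * lam i j l) * (X 0 * A i j k) by
    simp only [map_sub, map_mul, map_pow, aeval_X, aeval_C, algebraMap_eq,
      Matrix.cons_val_zero] at hv' ⊢
    linear_combination -hv'] at hQ
  simpa only [coeff_add, coeff_sub, coeff_C_mul] using hQ

end
end

section
/- Fix an integer m ≥ 2 and real constants b_{ij} = b_{ji} (1 ≤ i < j ≤ 4), and define, for each label (ij;k) with i,j,k ∈ {1,2,3,4}, the homogeneous polynomial of degree m+1: A_{ij;k}(x_{ij},x_{ik},x_{jk}) = x_{ik} x_{jk}·( m·b_{ij}·x_{ij}^{m−1} − b_{ik}·x_{ik}^{m−1} − b_{jk}·x_{jk}^{m−1} ). Then this family satisfies the homogeneous linear system (H): for all {i,j,k,ℓ} = {1,2,3,4}, x_{ik}·A_{jk;ℓ} + x_{jk}·A_{ik;ℓ} + x_{iℓ} x_{jℓ}·∂A_{ij;k}/∂x_{ij} + x_{iℓ} x_{kℓ}·∂A_{ij;k}/∂x_{ik} + x_{jℓ} x_{kℓ}·∂A_{ij;k}/∂x_{jk} − x_{iℓ}·A_{jℓ;k}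 − x_{jℓ}·A_{iℓ;k} − x_{ik} x_{jk}·∂A_{ij;ℓ}/∂x_{ij} − x_{ik} x_{kℓ}·∂A_{ij;ℓ}/∂x_{iℓ} − x_{jk} x_{kℓ}·∂A_{ij;ℓ}/∂x_{jℓ} = 0 identically in the six variables x_{pq} = x_{qp}, where each A_{pq;r} is evaluated at (x_{pq}, x_{pr}, x_{qr}). -/
/- Statement 13: the family
   `A_{ij;k} = x_{ik} x_{jk} (m b_{ij} x_{ij}^{m-1} - b_{ik} x_{ik}^{m-1} - b_{jk} x_{jk}^{m-1})`
   (for `m ≥ 2` and constants `b_{ij} = b_{ji}`) satisfies the homogeneous linear system (H). -/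

noncomputable section

open MvPolynomial

/-- The homogeneous linear system (H), as an identity in the six variables `x_{pq}`,
    for every `{i,j,k,ℓ} = {1,2,3,4}`. Since the three substituted variables are distinct,
    the partial derivative of `A_{ij;k}` with respect to its argument `x_{ij}`, evaluated at
    `(x_{ij}, x_{ik}, x_{jk})`, is `pderiv (vd i j)` of the evaluated polynomial, etc. -/
def SystemH (A : Fin 4 → Fin 4 → Fin 4 → MvPolynomial (Fin 3) ℝ) : Prop :=
  ∀ i j k l : Fin 4, ({i, j, k, l} : Finset (Fin 4)) = Finset.univ →
    xv i k * ev A j k l + xv j k * ev A i k l +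
        xv i l * xv j l * pderiv (vd i j) (ev A i j k) +
        xv i l * xv k l * pderiv (vd i k) (ev A i j k) +
        xv j l * xv k l * pderiv (vd j k) (ev A i j k) -
        xv i l * ev A j l k - xv j l * ev A i l k -
        xv i k * xv j k * pderiv (vd i j) (ev A i j l) -
        xv i k * xv k l * pderiv (vd i l) (ev A i j l) -
        xv j k * xv k l * pderiv (vd j l) (ev A i j l) = 0

theorem vd_comm (i j : Fin 4) : vd i j = vd j i := by
  revert i j; decide

theorem xv_comm (i j : Fin 4) : xv i j = xv j i := by
  rw [xv, xv, vd_comm]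

theorem vd_eq_iff (i j k l : Fin 4) :
    vd i j = vd k l ↔ (i = k ∧ j = l) ∨ (i = l ∧ j = k) := by
  revert i j k l; decide

theorem pairwise_ne_of_eq_univ (i j k l : Fin 4)
    (h : ({i, j, k, l} : Finset (Fin 4)) = Finset.univ) :
    i ≠ j ∧ i ≠ k ∧ i ≠ l ∧ j ≠ k ∧ j ≠ l ∧ k ≠ l := by
  revert i j k l; decide

theorem pderiv_xv (i j k l : Fin 4) :
    pderiv (vd i j) (xv k l) = if (k = i ∧ l = j) ∨ (k = j ∧ l = i) then 1 else 0 := by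
  simp only [xv, pderiv_X, Pi.single_apply, vd_eq_iff]

theorem stmt_13 (m : ℕ) (hm : 2 ≤ m) (b : Fin 4 → Fin 4 → ℝ)
    (hb : ∀ i j, b i j = b j i) :
    SystemH (fun i j k =>
      X 1 * X 2 * (C ((m : ℝ) * b i j) * X 0 ^ (m - 1) -
        C (b i k) * X 1 ^ (m - 1) - C (b j k) * X 2 ^ (m - 1))) := by
  obtain ⟨n, rfl⟩ := Nat.exists_eq_add_of_le' hm
  intro i j k l h
  obtain ⟨hij, hik, hil, hjk, hjl, -⟩ := pairwise_ne_of_eq_univ i j k l h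
  simp only [ev, map_mul, map_sub, map_pow, aeval_X, algHom_C, algebraMap_eq,
    Matrix.cons_val, Derivation.leibniz, Derivation.leibniz_pow, pderiv_C, pderiv_xv,
    smul_eq_mul, nsmul_eq_mul, map_natCast, Derivation.map_natCast]
  simp only [hij, hik, hil, hjk, hjl, hij.symm, hik.symm, hil.symm, hjk.symm, hjl.symm,
    and_true, and_false, or_false, if_true, if_false, and_self]
  rw [xv_comm l k, hb l k]
  push_cast
  ring

end
end
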